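/- arXiv:1504.08193 — 6 statements merged into one kernel-verified Lean document; each statement's English description precedes it below -/
import Mathlib

section
/- Let p ∈ (0,1) and γ = (1−√(1−p²))/p. If s : ℕ → ℝ is a nonnegative sequence satisfying s_i ≥ (p/2)s_{i−1} + (p/2)s_{i+1} for all i ≥ 1, then γ·s_i ≤ s_{i+1} for every i ≥ 0. -/
open MeasureTheory ProbabilityTheory Filter Topology


/-- If `g ∈ (0,1)` and the defects `s (i+1) - g * s i` of a nonnegative sequence grow by a factor
at most `g⁻¹`, then the initial defect is nonnegative: a negative one would force the sequence
below zero. -/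
lemma mul_le_of_defect_le {g : ℝ} (hg0 : 0 < g) (hg1 : g < 1) {s : ℕ → ℝ} (hs : ∀ i, 0 ≤ s i)
    (hd : ∀ i, g * (s (i + 2) - g * s (i + 1)) ≤ s (i + 1) - g * s i) :
    g * s 0 ≤ s 1 := by
  by_contra! hneg
  have defect_le (n : ℕ) : g ^ n * (s (n + 1) - g * s n) ≤ s 1 - g * s 0 := by
    induction n with
    | zero => simp
    | succ n ih =>
      have h := mul_le_mul_of_nonneg_left (hd n) (pow_nonneg hg0.le n)
      calc g ^ (n + 1) * (s (n + 2) - g * s (n + 1))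
          = g ^ n * (g * (s (n + 2) - g * s (n + 1))) := by ring
        _ ≤ _ := h.trans ih
  have step_le (n : ℕ) : s (n + 1) ≤ g * s n := by
    have h : g ^ n * (s (n + 1) - g * s n) < 0 := (defect_le n).trans_lt (by linarith)
    linarith [neg_of_mul_neg_right h (pow_nonneg hg0.le n)]
  have le_pow (n : ℕ) : s n ≤ g ^ n * s 0 := by
    induction n with
    | zero => simp
    | succ n ih =>
      calc s (n + 1) ≤ g * s n := step_le n
        _ ≤ g * (g ^ n * s 0) := by gcongr
        _ = g ^ (n + 1) * s 0 := by ring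
  have lower (n : ℕ) : -(g * (g ^ n * (g ^ n * s 0))) ≤ s 1 - g * s 0 := by
    refine le_trans ?_ (defect_le n)
    have h₁ := mul_le_mul_of_nonneg_left (le_pow n) (mul_nonneg hg0.le (pow_nonneg hg0.le n))
    have h₂ := mul_nonneg (pow_nonneg hg0.le n) (hs (n + 1))
    linarith
  have hpow := tendsto_pow_atTop_nhds_zero_of_lt_one hg0.le hg1
  have hlim := ((hpow.mul (hpow.mul_const (s 0))).const_mul g).neg
  have := le_of_tendsto' hlim lower
  simp only [zero_mul, mul_zero, neg_zero] at this
  linarith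

/-- if a nonnegative sequence satisfies
`s_i ≥ (p/2)s_{i-1} + (p/2)s_{i+1}` for all `i ≥ 1`, then with `γ = (1-√(1-p²))/p` one has
`γ·s_i ≤ s_{i+1}` for every `i`. -/
theorem geometric_growth_of_subharmonic (p : ℝ) (hp0 : 0 < p) (hp1 : p < 1)
    (s : ℕ → ℝ) (hs : ∀ i, 0 ≤ s i)
    (hrec : ∀ i : ℕ, s (i + 1) ≥ p / 2 * s i + p / 2 * s (i + 2)) :
    ∀ i : ℕ, (1 - Real.sqrt (1 - p ^ 2)) / p * s i ≤ s (i + 1) := by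
  have hsq : Real.sqrt (1 - p ^ 2) ^ 2 = 1 - p ^ 2 := Real.sq_sqrt (by nlinarith)
  have hr0 : 0 ≤ Real.sqrt (1 - p ^ 2) := Real.sqrt_nonneg _
  set r := Real.sqrt (1 - p ^ 2)
  have hr1 : r < 1 := by nlinarith
  have hpr : 1 - p < r := by nlinarith
  set g := (1 - r) / p with hg
  have hg0 : 0 < g := div_pos (by linarith) hp0
  have hg1 : g < 1 := (div_lt_one hp0).2 (by linarith)
  have hquad : 2 / p * g = 1 + g ^ 2 := by
    rw [hg]
    field_simp
    linarith
  intro i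
  refine mul_le_of_defect_le (s := fun n => s (i + n)) hg0 hg1 (fun n => hs _) fun n => ?_
  have h : s (i + n + 2) ≤ 2 / p * s (i + n + 1) - s (i + n) := by
    have h' := mul_le_mul_of_nonneg_left (hrec (i + n)) (by positivity : 0 ≤ 2 / p)
    have hp : 2 / p * (p / 2 * s (i + n) + p / 2 * s (i + n + 2)) = s (i + n) + s (i + n + 2) := by
      field_simp
    linarith
  have hmul := mul_le_mul_of_nonneg_left h hg0.le
  change g * (s (i + n + 2) - g * s (i + n + 1)) ≤ s (i + n + 1) - g * s (i + n)
  linear_combination hmul + s (i + n + 1) * hquad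
end

section
/- Let γ ∈ (0,1), let r : ℕ → ℝ be nonnegative, nondecreasing and bounded, and let s : ℕ → ℝ be a nonnegative summable sequence with γ·s_i ≤ s_{i+1} for all i. Define the geometric sequence s*_i = (1−γ)γ^i · ∑_{j=0}^∞ s_j (which has the same total sum as s). Then ∑_{i=0}^∞ s_i r_i ≥ ∑_{i=0}^∞ s*_i r_i. -/
open MeasureTheory ProbabilityTheory Filter Topology


/-- Tails of a summable sequence whose ratios are at least `γ` decay at most geometrically. -/
theorem pow_mul_tsum_le_tsum_nat_add {γ : ℝ} (hγ : 0 ≤ γ) {s : ℕ → ℝ} (hs : Summable s)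
    (hratio : ∀ i, γ * s i ≤ s (i + 1)) (n : ℕ) :
    γ ^ n * ∑' i, s i ≤ ∑' i, s (i + n) := by
  induction n with
  | zero => simp
  | succ n ih =>
    calc γ ^ (n + 1) * ∑' i, s i = γ * (γ ^ n * ∑' i, s i) := by ring
      _ ≤ γ * ∑' i, s (i + n) := by gcongr
      _ = ∑' i, γ * s (i + n) := tsum_mul_left.symm
      _ ≤ ∑' i, s (i + (n + 1)) :=
        (((summable_nat_add_iff n).2 hs).mul_left γ).tsum_le_tsum (fun i ↦ hratio (i + n))
          ((summable_nat_add_iff (n + 1)).2 hs)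

/-- If all tails of a summable sequence are nonnegative, so is its sum against a nonnegative,
nondecreasing, bounded weight. -/
theorem tsum_mul_nonneg_of_tails_nonneg {d r : ℕ → ℝ} (hd : Summable d)
    (htail : ∀ n, 0 ≤ ∑' i, d (i + n)) (hr0 : ∀ i, 0 ≤ r i) (hr : Monotone r)
    {B : ℝ} (hB : ∀ i, r i ≤ B) (hdr : Summable fun i ↦ d i * r i) :
    0 ≤ ∑' i, d i * r i := by
  have abel (n : ℕ) : 0 ≤ ∑ i ∈ Finset.range n, d i * r i + (∑' i, d (i + n)) * r n := by
    induction n with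
    | zero => simpa using mul_nonneg (htail 0) (hr0 0)
    | succ n ih =>
      have hsplit : ∑' i, d (i + n) = d n + ∑' i, d (i + (n + 1)) := by
        rw [((summable_nat_add_iff n).2 hd).tsum_eq_zero_add]
        simp [add_assoc, add_comm 1 n]
      have hstep := mul_le_mul_of_nonneg_left (hr n.le_succ) (htail (n + 1))
      rw [hsplit] at ih
      rw [Finset.sum_range_succ]
      simp only [Nat.succ_eq_add_one] at hstep
      linarith
  have hlim : Tendsto (fun n ↦ ∑ i ∈ Finset.range n, d i * r i + (∑' i, d (i + n)) * B)
      atTop (𝓝 (∑' i, d i * r i + 0 * B)) :=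
    hdr.hasSum.tendsto_sum_nat.add ((tendsto_sum_nat_add d).mul_const B)
  rw [zero_mul, add_zero] at hlim
  refine ge_of_tendsto' hlim fun n ↦ (abel n).trans ?_
  gcongr
  · exact htail n
  · exact hB n

/-- among nonnegative summable sequences with given total mass whose ratios
grow at least by `γ`, the extremal geometric sequence `s*_i = (1-γ)γ^i ∑ⱼ sⱼ` minimizes the
weighted sum against a nonnegative, nondecreasing, bounded weight sequence `r`. -/
theorem geometric_minimizes_weighted_sum (γ : ℝ) (hγ0 : 0 < γ) (hγ1 : γ < 1)
    (r s : ℕ → ℝ) (hr0 : ∀ i, 0 ≤ r i) (hrmono : ∀ i, r i ≤ r (i + 1)) (hrbdd : ∃ B, ∀ i, r i ≤ B)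
    (hs0 : ∀ i, 0 ≤ s i) (hsum : Summable s) (hratio : ∀ i, γ * s i ≤ s (i + 1)) :
    ∑' i : ℕ, s i * r i ≥ ∑' i : ℕ, ((1 - γ) * γ ^ i * ∑' j : ℕ, s j) * r i := by
  obtain ⟨B, hB⟩ := hrbdd
  have summable_mul_weight {u : ℕ → ℝ} (hu0 : ∀ i, 0 ≤ u i) (hu : Summable u) :
      Summable fun i ↦ u i * r i :=
    (hu.mul_right B).of_nonneg_of_le (fun i ↦ mul_nonneg (hu0 i) (hr0 i))
      fun i ↦ mul_le_mul_of_nonneg_left (hB i) (hu0 i)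
  set S := ∑' j, s j
  have hS0 : 0 ≤ S := tsum_nonneg hs0
  have hgeom : Summable fun i : ℕ ↦ (1 - γ) * γ ^ i * S :=
    ((summable_geometric_of_lt_one hγ0.le hγ1).mul_left (1 - γ)).mul_right S
  have hgeom0 (i : ℕ) : 0 ≤ (1 - γ) * γ ^ i * S :=
    mul_nonneg (mul_nonneg (sub_nonneg.2 hγ1.le) (pow_nonneg hγ0.le i)) hS0
  have hgeom_tail (n : ℕ) : ∑' i : ℕ, (1 - γ) * γ ^ (i + n) * S = γ ^ n * S := by
    have hne : 1 - γ ≠ 0 := (sub_pos.2 hγ1).ne'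
    simp_rw [pow_add]
    rw [tsum_mul_right, tsum_mul_left, tsum_mul_right, tsum_geometric_of_lt_one hγ0.le hγ1]
    field_simp
  have hsr := summable_mul_weight hs0 hsum
  have hgr := summable_mul_weight hgeom0 hgeom
  have hnonneg := tsum_mul_nonneg_of_tails_nonneg (r := r) (hsum.sub hgeom) (fun n ↦ ?_) hr0
    (monotone_nat_of_le_succ hrmono) hB (by simpa only [sub_mul] using hsr.sub hgr)
  · simp_rw [sub_mul (s _)] at hnonneg
    rw [hsr.tsum_sub hgr] at hnonneg
    exact sub_nonneg.1 hnonneg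
  · rw [((summable_nat_add_iff n).2 hsum).tsum_sub ((summable_nat_add_iff n).2 hgeom), hgeom_tail]
    exact sub_nonneg.2 (pow_mul_tsum_le_tsum_nat_add hγ0.le hsum hratio n)
end

section
/- For every γ ∈ [0,1): (1−γ) ∑_{i=1}^∞ γ^i ((2^i−1)/(2^i+1))² = γ − 4(1−γ) ∑_{i=1}^∞ (2γ)^i/(2^i+1)², and moreover γ − 4(1−γ) ∑_{i=1}^∞ (2γ)^i/(2^i+1)² ≥ γ − (8/9)γ(1−γ) − (2/(2−γ))γ²(1−γ). -/
open MeasureTheory ProbabilityTheory Filter Topology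


/-- Each term of the series is dominated by the corresponding power of `γ / 2`. -/
theorem two_mul_pow_div_two_pow_add_one_sq_le {γ : ℝ} (hγ : 0 ≤ γ) (n : ℕ) :
    (2 * γ) ^ n / ((2 : ℝ) ^ n + 1) ^ 2 ≤ (γ / 2) ^ n := by
  have h2 : (0 : ℝ) < 2 ^ n := by positivity
  have hg : 0 ≤ γ ^ n := pow_nonneg hγ n
  rw [mul_pow, div_pow, div_le_div_iff₀ (by positivity) h2]
  nlinarith [mul_nonneg hg h2.le]

theorem summable_two_mul_pow_div_two_pow_add_one_sq {γ : ℝ} (hγ0 : 0 ≤ γ) (hγ2 : γ < 2) :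
    Summable fun n : ℕ => (2 * γ) ^ n / ((2 : ℝ) ^ n + 1) ^ 2 :=
  Summable.of_nonneg_of_le (fun n => by positivity)
    (two_mul_pow_div_two_pow_add_one_sq_le hγ0)
    (summable_geometric_of_lt_one (by linarith) (by linarith))

theorem pow_mul_sub_one_div_add_one_sq (γ : ℝ) (n : ℕ) :
    γ ^ n * (((2 : ℝ) ^ n - 1) / ((2 : ℝ) ^ n + 1)) ^ 2 =
      γ ^ n - 4 * ((2 * γ) ^ n / ((2 : ℝ) ^ n + 1) ^ 2) := by
  have h2 : (2 : ℝ) ^ n + 1 ≠ 0 := by positivity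
  rw [mul_pow]
  field_simp
  ring

theorem tsum_two_mul_pow_div_two_pow_add_one_sq_le {γ : ℝ} (hγ0 : 0 ≤ γ) (hγ2 : γ < 2) :
    ∑' i : ℕ, (2 * γ) ^ (i + 1) / ((2 : ℝ) ^ (i + 1) + 1) ^ 2 ≤
      2 / 9 * γ + γ ^ 2 / (2 * (2 - γ)) := by
  have hs := summable_two_mul_pow_div_two_pow_add_one_sq hγ0 hγ2
  have hgeom : HasSum (fun i : ℕ => (γ / 2) ^ (i + 2)) (γ ^ 2 / (2 * (2 - γ))) := by
    have h := (hasSum_geometric_of_lt_one (r := γ / 2) (by linarith) (by linarith)).mul_right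
      ((γ / 2) ^ 2)
    have h0 : 2 - γ ≠ 0 := by linarith
    have h1 : 1 - γ / 2 ≠ 0 := by linarith
    have hv : (1 - γ / 2)⁻¹ * (γ / 2) ^ 2 = γ ^ 2 / (2 * (2 - γ)) := by
      field_simp
    simpa only [pow_add, hv] using h
  have htail := ((summable_nat_add_iff 2).mpr hs).tsum_le_tsum
    (fun i => two_mul_pow_div_two_pow_add_one_sq_le hγ0 (i + 2)) hgeom.summable
  rw [hgeom.tsum_eq] at htail
  rw [((summable_nat_add_iff 1).mpr hs).tsum_eq_zero_add]
  norm_num [add_assoc] at htail ⊢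
  linarith

/-- closed-form identity and simplification for the geometric lower-bound
series. -/
theorem lower_bound_series_identity (γ : ℝ) (hγ0 : 0 ≤ γ) (hγ1 : γ < 1) :
    ((1 - γ) * ∑' i : ℕ, γ ^ (i + 1) * (((2 : ℝ) ^ (i + 1) - 1) / ((2 : ℝ) ^ (i + 1) + 1)) ^ 2 =
      γ - 4 * (1 - γ) * ∑' i : ℕ, (2 * γ) ^ (i + 1) / ((2 : ℝ) ^ (i + 1) + 1) ^ 2) ∧
    γ - 4 * (1 - γ) * (∑' i : ℕ, (2 * γ) ^ (i + 1) / ((2 : ℝ) ^ (i + 1) + 1) ^ 2) ≥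
      γ - 8 / 9 * γ * (1 - γ) - 2 / (2 - γ) * γ ^ 2 * (1 - γ) := by
  refine ⟨?_, ?_⟩
  · have hs := (summable_nat_add_iff 1).mpr
      (summable_two_mul_pow_div_two_pow_add_one_sq hγ0 (by linarith))
    have hg := (summable_nat_add_iff 1).mpr (summable_geometric_of_lt_one hγ0 hγ1)
    have h1 : 1 - γ ≠ 0 := by linarith
    simp only [pow_mul_sub_one_div_add_one_sq]
    rw [hg.tsum_sub (hs.mul_left 4), tsum_mul_left]
    simp only [pow_succ γ, tsum_mul_right, tsum_geometric_of_lt_one hγ0 hγ1]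
    field_simp
  · have h := mul_le_mul_of_nonneg_left
      (tsum_two_mul_pow_div_two_pow_add_one_sq_le hγ0 (by linarith))
      (show 0 ≤ 4 * (1 - γ) by linarith)
    have h0 : 2 - γ ≠ 0 := by linarith
    have hv : 4 * (1 - γ) * (2 / 9 * γ + γ ^ 2 / (2 * (2 - γ))) =
        8 / 9 * γ * (1 - γ) + 2 / (2 - γ) * γ ^ 2 * (1 - γ) := by
      field_simp
      ring
    linarith
end

section
/- For every p ∈ (0,1) and every integer a ≥ 0: ∑_{l=0}^∞ (1−p) · p^{2l+a} · C(2l+a, l) · 2^{−(2l+a)} = √((1−p)/(1+p)) · ((1−√(1−p²))/p)^a, where C(m,k) denotes the binomial coefficient. -/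
open MeasureTheory ProbabilityTheory Filter Topology

/-- The `l`-th term of the generating function `∑ C(2l+a, l) x^(2l+a)`. -/
noncomputable def shiftedCentralTerm (x : ℝ) (a l : ℕ) : ℝ :=
  x ^ (2 * l + a) * (Nat.choose (2 * l + a) l : ℝ)

theorem shiftedCentralTerm_nonneg {x : ℝ} (hx : 0 ≤ x) (a l : ℕ) :
    0 ≤ shiftedCentralTerm x a l := by
  unfold shiftedCentralTerm
  positivity

theorem shiftedCentralTerm_le {x : ℝ} (hx : 0 ≤ x) (hx2 : 2 * x ≤ 1) (a l : ℕ) :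
    shiftedCentralTerm x a l ≤ (2 * x) ^ l := by
  have hchoose : (Nat.choose (2 * l + a) l : ℝ) ≤ 2 ^ (2 * l + a) := by
    exact_mod_cast Nat.choose_le_two_pow (2 * l + a) l
  calc shiftedCentralTerm x a l ≤ x ^ (2 * l + a) * 2 ^ (2 * l + a) :=
        mul_le_mul_of_nonneg_left hchoose (by positivity)
    _ = (2 * x) ^ (2 * l + a) := by rw [mul_pow, mul_comm]
    _ ≤ (2 * x) ^ l := pow_le_pow_of_le_one (by positivity) hx2 (by omega)

theorem summable_shiftedCentralTerm {x : ℝ} (hx : 0 ≤ x) (hx2 : 2 * x < 1) (a : ℕ) :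
    Summable (shiftedCentralTerm x a) :=
  Summable.of_nonneg_of_le (shiftedCentralTerm_nonneg hx a)
    (shiftedCentralTerm_le hx hx2.le a) (summable_geometric_of_lt_one (by positivity) hx2)

theorem tsum_shiftedCentralTerm_le {x : ℝ} (hx : 0 ≤ x) (hx2 : 2 * x < 1) (a : ℕ) :
    ∑' l, shiftedCentralTerm x a l ≤ (1 - 2 * x)⁻¹ := by
  rw [← tsum_geometric_of_lt_one (by positivity) hx2]
  exact (summable_shiftedCentralTerm hx hx2 a).tsum_le_tsum
    (shiftedCentralTerm_le hx hx2.le a) (summable_geometric_of_lt_one (by positivity) hx2)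

theorem tsum_shiftedCentralTerm_zero {x : ℝ} (hx : 0 ≤ x) (hx2 : 2 * x < 1) :
    ∑' l, shiftedCentralTerm x 0 l = 1 + 2 * x * ∑' l, shiftedCentralTerm x 1 l := by
  have hterm (l : ℕ) : shiftedCentralTerm x 0 (l + 1) = 2 * x * shiftedCentralTerm x 1 l := by
    have hchoose : Nat.choose (2 * l + 2) (l + 1) = 2 * Nat.choose (2 * l + 1) l := by
      rw [Nat.choose_succ_succ' (2 * l + 1) l, Nat.choose_symm_half]
      ring
    simp only [shiftedCentralTerm, add_zero, mul_add, mul_one, hchoose]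
    push_cast
    ring
  rw [(summable_shiftedCentralTerm hx hx2 0).tsum_eq_zero_add]
  simp_rw [hterm]
  rw [tsum_mul_left]
  simp [shiftedCentralTerm]

theorem tsum_shiftedCentralTerm_succ {x : ℝ} (hx : 0 ≤ x) (hx2 : 2 * x < 1) (a : ℕ) :
    ∑' l, shiftedCentralTerm x (a + 1) l =
      x * (∑' l, shiftedCentralTerm x a l + ∑' l, shiftedCentralTerm x (a + 2) l) := by
  have hterm (l : ℕ) : shiftedCentralTerm x (a + 1) (l + 1) =
      x * (shiftedCentralTerm x a (l + 1) + shiftedCentralTerm x (a + 2) l) := by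
    have hchoose : Nat.choose (2 * (l + 1) + (a + 1)) (l + 1) =
        Nat.choose (2 * l + (a + 2)) l + Nat.choose (2 * (l + 1) + a) (l + 1) := by
      rw [show 2 * (l + 1) + (a + 1) = (2 * l + (a + 2)) + 1 by ring,
        Nat.choose_succ_succ', show 2 * (l + 1) + a = 2 * l + (a + 2) by ring]
    simp only [shiftedCentralTerm, hchoose]
    push_cast
    ring
  have hs := summable_shiftedCentralTerm hx hx2
  rw [(hs (a + 1)).tsum_eq_zero_add, (hs a).tsum_eq_zero_add]
  simp_rw [hterm]
  rw [tsum_mul_left, ((summable_nat_add_iff 1).2 (hs a)).tsum_add (hs (a + 2))]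
  simp only [shiftedCentralTerm, Nat.choose_zero_right]
  ring

/-- A bounded solution of `u (n+1) = x (u n + u (n+2))` is geometric, with ratio the root `r` of
modulus less than one of the characteristic equation. -/
theorem eq_mul_pow_of_bounded_of_recurrence {u : ℕ → ℝ} {x r C : ℝ} (hx : x ≠ 0)
    (hr : |r| < 1) (hroot : r = x * (1 + r ^ 2)) (hC : ∀ n, |u n| ≤ C)
    (hu : ∀ n, u (n + 1) = x * (u n + u (n + 2))) (n : ℕ) : u n = u 0 * r ^ n := by
  have hstep (n : ℕ) : u (n + 1) - r * u n = r * (u (n + 2) - r * u (n + 1)) := by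
    apply mul_left_cancel₀ hx
    linear_combination r * hu n - u (n + 1) * hroot
  have hiter (n k : ℕ) : u (n + 1) - r * u n = r ^ k * (u (n + k + 1) - r * u (n + k)) := by
    induction k with
    | zero => simp
    | succ k ih => rw [ih, hstep (n + k)]; ring_nf
  have hzero (n : ℕ) : u (n + 1) - r * u n = 0 := by
    have hlim : Tendsto (fun k => r ^ k * (u (n + k + 1) - r * u (n + k))) atTop (𝓝 0) := by
      refine (tendsto_pow_atTop_nhds_zero_of_abs_lt_one hr).zero_mul_isBoundedUnder_le
        (isBoundedUnder_of ⟨C + |r| * C, fun k => ?_⟩)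
      calc |u (n + k + 1) - r * u (n + k)| ≤ |u (n + k + 1)| + |r * u (n + k)| := abs_sub _ _
        _ ≤ C + |r| * C := by
          rw [abs_mul]
          gcongr <;> exact hC _
    simp_rw [← hiter n] at hlim
    exact tendsto_nhds_unique tendsto_const_nhds hlim
  induction n with
  | zero => simp
  | succ n ih => linear_combination hzero n + r * ih

/-- the generating-function identity
`∑_{l=0}^∞ (1-p) p^{2l+a} C(2l+a,l) 2^{-(2l+a)} = √((1-p)/(1+p)) · ((1-√(1-p²))/p)^a`. -/
theorem failure_count_difference_distribution (p : ℝ) (hp0 : 0 < p) (hp1 : p < 1) (a : ℕ) :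
    ∑' l : ℕ, (1 - p) * p ^ (2 * l + a) * (Nat.choose (2 * l + a) l : ℝ) / 2 ^ (2 * l + a) =
      Real.sqrt ((1 - p) / (1 + p)) * ((1 - Real.sqrt (1 - p ^ 2)) / p) ^ a := by
  have hx : 0 ≤ p / 2 := by positivity
  have hx2 : 2 * (p / 2) < 1 := by linarith
  have hpos : 0 < 1 - p ^ 2 := by nlinarith
  set s := Real.sqrt (1 - p ^ 2) with hs
  have hs0 : 0 < s := Real.sqrt_pos.2 hpos
  have hsq : s ^ 2 = 1 - p ^ 2 := Real.sq_sqrt hpos.le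
  set r := (1 - s) / p with hr
  have hpr : p * r = 1 - s := by rw [hr]; field_simp
  have hr1 : |r| < 1 := by
    rw [abs_lt, hr, lt_div_iff₀ hp0, div_lt_one hp0]
    constructor <;> nlinarith
  have hroot : r = p / 2 * (1 + r ^ 2) := by
    rw [hr]
    field_simp
    linear_combination -hsq
  set S : ℕ → ℝ := fun n => ∑' l, shiftedCentralTerm (p / 2) n l with hS
  have hgeom : ∀ n, S n = S 0 * r ^ n :=
    eq_mul_pow_of_bounded_of_recurrence (by positivity) hr1 hroot
      (fun n => by
        rw [abs_of_nonneg (tsum_nonneg (shiftedCentralTerm_nonneg hx n))]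
        exact tsum_shiftedCentralTerm_le hx hx2 n)
      (tsum_shiftedCentralTerm_succ hx hx2)
  have hS0 : S 0 * s = 1 := by
    have h0 : S 0 = 1 + 2 * (p / 2) * S 1 := tsum_shiftedCentralTerm_zero hx hx2
    linear_combination h0 + p * hgeom 1 + S 0 * hpr
  have hsqrt : Real.sqrt ((1 - p) / (1 + p)) = (1 - p) * S 0 := by
    rw [eq_div_of_mul_eq hs0.ne' hS0, mul_one_div]
    have h1 : 1 - p ≠ 0 := by linarith
    have hsquare : (1 - p) / (1 + p) = ((1 - p) / s) ^ 2 := by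
      rw [div_pow, hsq, show 1 - p ^ 2 = (1 - p) * (1 + p) by ring]
      field_simp
    rw [hsquare, Real.sqrt_sq (div_nonneg (by linarith) hs0.le)]
  rw [hsqrt, mul_assoc, ← hgeom a, hS, ← tsum_mul_left]
  congr 1 with l
  rw [shiftedCentralTerm, div_pow]
  ring
end

section
/- For every p ∈ [0,1]: ∑_{i=0}^∞ p(1−p)^{i+2}/(2^{i+1}+1)² + (9/25)·(2p(1−p)²/(1+p²)) + 2p²(1−p²)/(1+p²) + (9/25)·(p²(1−p)²/(1+p²)) + 2p³/(1+p²) ≤ p(1−p)²/(3+p) + (p/(25(1+p²)))·(18 + 23p + 50p² − 41p³). -/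
open MeasureTheory ProbabilityTheory Filter Topology

/-- Termwise comparison with the geometric series of ratio `(1 - p) / 4`. -/
theorem tsum_div_two_pow_add_one_sq_le (p : ℝ) (hp : p ∈ Set.Icc (0 : ℝ) 1) :
    ∑' i : ℕ, p * (1 - p) ^ (i + 2) / ((2 : ℝ) ^ (i + 1) + 1) ^ 2 ≤
      p * (1 - p) ^ 2 / (3 + p) := by
  obtain ⟨h0, h1⟩ := hp
  have hq : 0 ≤ 1 - p := by linarith
  have hg : HasSum (fun i : ℕ => p * (1 - p) ^ 2 / 4 * ((1 - p) / 4) ^ i)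
      (p * (1 - p) ^ 2 / (3 + p)) := by
    have h3 : 3 + p ≠ 0 := by positivity
    have hsum : p * (1 - p) ^ 2 / (3 + p) =
        p * (1 - p) ^ 2 / 4 * (1 - (1 - p) / 4)⁻¹ := by
      rw [show 1 - (1 - p) / 4 = (3 + p) / 4 by ring]
      field_simp
    rw [hsum]
    exact (hasSum_geometric_of_lt_one (by positivity) (by linarith)).mul_left _
  have hle (i : ℕ) : p * (1 - p) ^ (i + 2) / ((2 : ℝ) ^ (i + 1) + 1) ^ 2 ≤
      p * (1 - p) ^ 2 / 4 * ((1 - p) / 4) ^ i := by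
    have h4 : p * (1 - p) ^ 2 / 4 * ((1 - p) / 4) ^ i =
        p * (1 - p) ^ (i + 2) / ((2 : ℝ) ^ (i + 1)) ^ 2 := by
      rw [← pow_mul, mul_comm (i + 1), pow_mul, div_pow, pow_succ, pow_add]
      norm_num
      field_simp
      ring
    rw [h4]
    gcongr
    linarith
  have hs := Summable.of_nonneg_of_le (fun i => by positivity) hle hg.summable
  exact hasSum_le hle hs.hasSum hg

/-- the final summation estimate of the general upper bound. -/
theorem upper_bound_final_estimate (p : ℝ) (hp : p ∈ Set.Icc (0 : ℝ) 1) :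
    (∑' i : ℕ, p * (1 - p) ^ (i + 2) / ((2 : ℝ) ^ (i + 1) + 1) ^ 2) +
        9 / 25 * (2 * p * (1 - p) ^ 2 / (1 + p ^ 2)) + 2 * p ^ 2 * (1 - p ^ 2) / (1 + p ^ 2) +
        9 / 25 * (p ^ 2 * (1 - p) ^ 2 / (1 + p ^ 2)) + 2 * p ^ 3 / (1 + p ^ 2) ≤
      p * (1 - p) ^ 2 / (3 + p) +
        p / (25 * (1 + p ^ 2)) * (18 + 23 * p + 50 * p ^ 2 - 41 * p ^ 3) := by
  have key : 9 / 25 * (2 * p * (1 - p) ^ 2 / (1 + p ^ 2)) +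
      2 * p ^ 2 * (1 - p ^ 2) / (1 + p ^ 2) +
      9 / 25 * (p ^ 2 * (1 - p) ^ 2 / (1 + p ^ 2)) + 2 * p ^ 3 / (1 + p ^ 2) =
      p / (25 * (1 + p ^ 2)) * (18 + 23 * p + 50 * p ^ 2 - 41 * p ^ 3) := by
    have : 1 + p ^ 2 ≠ 0 := by positivity
    field_simp
    ring
  linarith [tsum_div_two_pow_add_one_sq_le p hp]
end

section
/- Let x_i, x_j, w_i, w_j, α be real numbers with w_i ≥ w_j > 0 and α > 0. Then |x_i/w_i − (x_j + α·x_i)/(w_j + α·w_i)| ≤ (1/(1+α)) · |x_i/w_i − x_j/w_j|. -/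
open MeasureTheory ProbabilityTheory Filter Topology


/-- receiving a positive fraction `α` of the largest-weight node's mass pulls
the receiving node's ratio towards the sender's ratio by a factor `1/(1+α)`. -/
theorem ratio_contraction (xi xj wi wj α : ℝ) (hw : wi ≥ wj) (hwj : 0 < wj) (hα : 0 < α) :
    |xi / wi - (xj + α * xi) / (wj + α * wi)| ≤ 1 / (1 + α) * |xi / wi - xj / wj| := by
  have hwi : 0 < wi := hwj.trans_le hw
  have hsum : 0 < wj + α * wi := by positivity
  have hfactor : xi / wi - (xj + α * xi) / (wj + α * wi) =
      wj / (wj + α * wi) * (xi / wi - xj / wj) := by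
    field_simp
    ring
  rw [hfactor, abs_mul, abs_of_pos (div_pos hwj hsum)]
  refine mul_le_mul_of_nonneg_right ?_ (abs_nonneg _)
  rw [div_le_div_iff₀ hsum (by positivity)]
  nlinarith [mul_le_mul_of_nonneg_left hw hα.le]
end
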